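/- arXiv:2503.17591 — 3 statements merged into one kernel-verified Lean document; each statement's English description precedes it below -/
import Mathlib

section
/- Let η be a real number with 0 < η < 1, let N ≥ 1 be a natural number, and let ω be a real number with 1/(2-η) ≤ ω < 1. Set a = ω/(1-ω). Then a^(N-1) (a-1)/(a^N - 1) ≥ η. -/
theorem stmt1 (η : ℝ) (hη0 : 0 < η) (hη1 : η < 1)
    (N : ℕ) (hN : 1 ≤ N)
    (ω : ℝ) (hω : 1 / (2 - η) ≤ ω) (hω1 : ω < 1)
    (a : ℝ) (ha : a = ω / (1 - ω)) :
    a ^ (N - 1) * (a - 1) / (a ^ N - 1) ≥ η := by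
  obtain ⟨k, rfl⟩ : ∃ k, N = k + 1 := ⟨N - 1, by omega⟩
  have h1 : 1 ≤ ω * (2 - η) := (div_le_iff₀ (by linarith)).1 hω
  have h2 : 0 < 1 - ω := by linarith
  have h3 : 1 ≤ a * (1 - η) := by
    rw [ha, div_mul_eq_mul_div, le_div_iff₀ h2]
    linarith
  have h4 : 1 < a := by
    by_contra h
    have h5 : a * (1 - η) ≤ 1 * (1 - η) :=
      mul_le_mul_of_nonneg_right (not_lt.1 h) (by linarith)
    linarith
  have h6 : 1 < a ^ (k + 1) := one_lt_pow₀ h4 (by omega)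
  have h7 : 0 < a ^ k := pow_pos (by linarith) k
  have h8 : 0 ≤ a ^ k * (a * (1 - η) - 1) := mul_nonneg h7.le (by linarith)
  rw [ge_iff_le, le_div_iff₀ (by linarith), Nat.add_sub_cancel, pow_succ]
  linarith
end

section
/- Let d be a positive natural number, let U ∈ Matrix (Fin d) (Fin d) ℂ be unitary, and let ω, λ be real numbers with ω + λ = 1. Define Φ on pairs of matrices by Φ(A, B) = (λ • A + λ • Uᴴ * B * U, ω • U * A * Uᴴ + ω • B). Then Φ is idempotent: for all A, B ∈ Matrix (Fin d) (Fin d) ℂ, Φ(Φ(A, B)) = Φ(A, B). Consequently, the two-node linear open quantum walk started from any graph-diagonal state A ⊗ₖ E 0 0 + B ⊗ₖ E 1 1 reaches its steady state after a single step: the state after n steps equals the state after one step for every n ≥ 1. -/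
open scoped Matrix

theorem stmt6 (d : ℕ) (hd : 0 < d)
    (U : Matrix (Fin d) (Fin d) ℂ) (hU : Uᴴ * U = 1) (hU' : U * Uᴴ = 1)
    (ω lam : ℝ) (hsum : ω + lam = 1)
    (Φ : Matrix (Fin d) (Fin d) ℂ × Matrix (Fin d) (Fin d) ℂ →
      Matrix (Fin d) (Fin d) ℂ × Matrix (Fin d) (Fin d) ℂ)
    (hΦ : ∀ A B : Matrix (Fin d) (Fin d) ℂ,
      Φ (A, B) = ((lam : ℂ) • A + (lam : ℂ) • (Uᴴ * B * U),
        (ω : ℂ) • (U * A * Uᴴ) + (ω : ℂ) • B)) :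
    (∀ A B : Matrix (Fin d) (Fin d) ℂ, Φ (Φ (A, B)) = Φ (A, B)) ∧
      ∀ n : ℕ, 1 ≤ n → ∀ A B : Matrix (Fin d) (Fin d) ℂ,
        Φ^[n] (A, B) = Φ (A, B) := by
  have key : ∀ A B : Matrix (Fin d) (Fin d) ℂ, Φ (Φ (A, B)) = Φ (A, B) := by
    intro A B
    have hs : (ω : ℂ) = 1 - (lam : ℂ) := by
      rw [eq_sub_iff_add_eq]
      exact_mod_cast hsum
    have e1 : ∀ X : Matrix (Fin d) (Fin d) ℂ, Uᴴ * (U * X * Uᴴ) * U = X := by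
      intro X
      calc Uᴴ * (U * X * Uᴴ) * U = (Uᴴ * U) * X * (Uᴴ * U) := by
            simp only [Matrix.mul_assoc]
        _ = X := by rw [hU, Matrix.one_mul, Matrix.mul_one]
    have e2 : ∀ X : Matrix (Fin d) (Fin d) ℂ, U * (Uᴴ * X * U) * Uᴴ = X := by
      intro X
      calc U * (Uᴴ * X * U) * Uᴴ = (U * Uᴴ) * X * (U * Uᴴ) := by
            simp only [Matrix.mul_assoc]
        _ = X := by rw [hU', Matrix.one_mul, Matrix.mul_one]
    rw [hΦ A B, hΦ]
    simp only [Matrix.mul_add, Matrix.add_mul, Matrix.mul_smul, Matrix.smul_mul, e1, e2, hs]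
    refine Prod.ext ?_ ?_
    · dsimp only
      module
    · dsimp only
      module
  refine ⟨key, ?_⟩
  intro n hn A B
  induction n, hn using Nat.le_induction with
  | base => rfl
  | succ k hk ih => rw [Function.iterate_succ_apply', ih, key]
end

section
/- Let N ≥ 2 be a natural number, let ω be a real number with 0 < ω < 1 and ω ≠ 1/2, let λ = 1 - ω and a = ω/λ. Let T be the N×N real transition matrix with T 0 0 = λ, T 0 1 = λ, T (N-1) (N-2) = ω, T (N-1) (N-1) = ω, T i (i-1) = ω and T i (i+1) = λ for 0 < i < N-1, and all other entries 0, and let x : Fin N → ℝ be given by x m = a^m (a-1)/(a^N - 1). Then for every probability vector p : Fin N → ℝ (i.e., p m ≥ 0 for all m and ∑_m p m = 1), the iterates converge to the steady state: Tendsto (fun n => (T ^ n).mulVec p) atTop (nhds x). -/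
open scoped Matrix BigOperators

lemma l1_step {N : ℕ} (M : Matrix (Fin N) (Fin N) ℝ) (i0 : Fin N) (δ : ℝ)
    (h0 : ∀ i j, 0 ≤ M i j) (hc : ∀ j, ∑ i, M i j = 1) (hd : ∀ j, δ ≤ M i0 j)
    (v : Fin N → ℝ) (hv : ∑ j, v j = 0) :
    ∑ i, |M.mulVec v i| ≤ (1 - δ) * ∑ j, |v j| := by
  have h1 : ∀ i, M.mulVec v i = ∑ j, (M i j - if i = i0 then δ else 0) * v j := by
    intro i
    simp only [sub_mul, Finset.sum_sub_distrib, ← Finset.mul_sum, hv, mul_zero, sub_zero]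
    rfl
  calc ∑ i, |M.mulVec v i| ≤ ∑ i, ∑ j, (M i j - if i = i0 then δ else 0) * |v j| := by
        refine Finset.sum_le_sum fun i _ => ?_
        rw [h1]
        refine (Finset.abs_sum_le_sum_abs _ _).trans (Finset.sum_le_sum fun j _ => ?_)
        rw [abs_mul, abs_of_nonneg]
        split_ifs with h
        · subst h; linarith [hd j]
        · linarith [h0 i j]
    _ = _ := by
        rw [Finset.sum_comm, Finset.mul_sum]
        refine Finset.sum_congr rfl fun j _ => ?_
        rw [← Finset.sum_mul, Finset.sum_sub_distrib, hc]
        simp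

lemma pow_stoch {N : ℕ} (M : Matrix (Fin N) (Fin N) ℝ)
    (h0 : ∀ i j, 0 ≤ M i j) (hc : ∀ j, ∑ i, M i j = 1) (n : ℕ) :
    (∀ i j, 0 ≤ (M ^ n) i j) ∧ (∀ j, ∑ i, (M ^ n) i j = 1) := by
  induction n with
  | zero =>
    refine ⟨fun i j => ?_, fun j => ?_⟩
    · rw [pow_zero, Matrix.one_apply]; split_ifs <;> norm_num
    · simp [Matrix.one_apply]
  | succ n ih =>
    refine ⟨fun i j => ?_, fun j => ?_⟩
    · rw [pow_succ, Matrix.mul_apply]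
      exact Finset.sum_nonneg fun k _ => mul_nonneg (ih.1 _ _) (h0 _ _)
    · simp only [pow_succ, Matrix.mul_apply]
      rw [Finset.sum_comm]
      simp only [← Finset.sum_mul, ih.2, one_mul, hc]

lemma sum_mulVec {N : ℕ} (M : Matrix (Fin N) (Fin N) ℝ)
    (hc : ∀ j, ∑ i, M i j = 1) (v : Fin N → ℝ) : ∑ i, M.mulVec v i = ∑ j, v j := by
  simp only [Matrix.mulVec, dotProduct]
  rw [Finset.sum_comm]
  simp only [← Finset.sum_mul, hc, one_mul]

lemma l1_tendsto {N : ℕ} (T : Matrix (Fin N) (Fin N) ℝ) (i0 : Fin N) (δ : ℝ) (hδ : 0 < δ) (K : ℕ)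
    (h0 : ∀ i j, 0 ≤ T i j) (hc : ∀ j, ∑ i, T i j = 1) (hd : ∀ j, δ ≤ (T ^ K) i0 j)
    (v : Fin N → ℝ) (hv : ∑ j, v j = 0) :
    Filter.Tendsto (fun n : ℕ => ∑ i, |(T ^ n).mulVec v i|) Filter.atTop (nhds 0) := by
  have hs : ∀ n, ∑ i, (T ^ n).mulVec v i = 0 := fun n => by
    rw [sum_mulVec _ (pow_stoch T h0 hc n).2, hv]
  have hanti : Antitone (fun n : ℕ => ∑ i, |(T ^ n).mulVec v i|) := by
    refine antitone_nat_of_succ_le fun n => ?_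
    have := l1_step T i0 0 h0 hc (fun j => h0 _ _) _ (hs n)
    simpa [Matrix.mulVec_mulVec, ← pow_succ'] using this
  have hbd : BddBelow (Set.range (fun n : ℕ => ∑ i, |(T ^ n).mulVec v i|)) :=
    ⟨0, by rintro _ ⟨n, rfl⟩; exact Finset.sum_nonneg fun i _ => abs_nonneg _⟩
  have hl := tendsto_atTop_ciInf hanti hbd
  set L := ⨅ n : ℕ, ∑ i, |(T ^ n).mulVec v i| with hL
  have hL0 : 0 ≤ L := ge_of_tendsto' hl fun n => Finset.sum_nonneg fun i _ => abs_nonneg _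
  have hstep : ∀ n, ∑ i, |(T ^ (n + K)).mulVec v i| ≤ (1 - δ) * ∑ i, |(T ^ n).mulVec v i| := by
    intro n
    have := l1_step (T ^ K) i0 δ (pow_stoch T h0 hc K).1 (pow_stoch T h0 hc K).2 hd _ (hs n)
    simpa [Matrix.mulVec_mulVec, ← pow_add, add_comm K n] using this
  have h2 := le_of_tendsto_of_tendsto' ((Filter.tendsto_add_atTop_iff_nat K).2 hl)
    (hl.const_mul (1 - δ)) hstep
  have : L = 0 := by nlinarith
  rwa [this] at hl

theorem stmt13 (N : ℕ) (hN : 2 ≤ N) (ω lam a : ℝ)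
    (hω0 : 0 < ω) (hω1 : ω < 1) (hωhalf : ω ≠ 1 / 2)
    (hlam : lam = 1 - ω) (ha : a = ω / lam)
    (T : Matrix (Fin N) (Fin N) ℝ)
    (hT : ∀ i j : Fin N, T i j =
      if (i : ℕ) = 0 ∧ (j : ℕ) = 0 then lam
      else if (i : ℕ) = 0 ∧ (j : ℕ) = 1 then lam
      else if (i : ℕ) = N - 1 ∧ (j : ℕ) = N - 2 then ω
      else if (i : ℕ) = N - 1 ∧ (j : ℕ) = N - 1 then ω
      else if 0 < (i : ℕ) ∧ (i : ℕ) < N - 1 ∧ (j : ℕ) = (i : ℕ) - 1 then ω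
      else if 0 < (i : ℕ) ∧ (i : ℕ) < N - 1 ∧ (j : ℕ) = (i : ℕ) + 1 then lam
      else 0)
    (x : Fin N → ℝ)
    (hx : ∀ m : Fin N, x m = a ^ (m : ℕ) * (a - 1) / (a ^ N - 1))
    (p : Fin N → ℝ) (hp0 : ∀ m, 0 ≤ p m) (hp1 : ∑ m, p m = 1) :
    Filter.Tendsto (fun n : ℕ => (T ^ n).mulVec p) Filter.atTop (nhds x) := by
  obtain ⟨M, rfl⟩ : ∃ M, N = M + 2 := ⟨N - 2, by omega⟩
  have hlam0 : 0 < lam := by linarith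
  have ha0 : 0 < a := by rw [ha]; positivity
  have hal : lam * a = ω := by rw [ha]; field_simp
  have ha1 : a ≠ 1 := by
    intro h; rw [h] at hal; apply hωhalf; linarith
  have haN : a ^ (M + 2) - 1 ≠ 0 := by
    intro h
    exact ha1 ((pow_eq_one_iff_of_nonneg ha0.le (n := M + 2) (by omega)).1 (by linarith))
  have hT' : ∀ i j : Fin (M + 2), T i j =
      (if (⟨(j : ℕ) - 1, by omega⟩ : Fin (M + 2)) = i then lam else 0) +
      (if (⟨min ((j : ℕ) + 1) (M + 1), by omega⟩ : Fin (M + 2)) = i then ω else 0) := by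
    intro i j
    rw [hT]
    have := i.2
    have := j.2
    simp only [Fin.ext_iff]
    generalize (i : ℕ) = k at *
    generalize (j : ℕ) = l at *
    split_ifs <;> first | omega | simp
  have h0 : ∀ i j, 0 ≤ T i j := by
    intro i j
    rw [hT']
    split_ifs <;> linarith
  have hc : ∀ j, ∑ i, T i j = 1 := by
    intro j
    simp only [hT', Finset.sum_add_distrib, Finset.sum_ite_eq, Finset.mem_univ, if_true]
    linarith
  have hdb : ∀ i j : Fin (M + 2), T i j * a ^ (j : ℕ) = T j i * a ^ (i : ℕ) := by
    intro i j
    rw [hT', hT']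
    have := i.2
    have := j.2
    simp only [Fin.ext_iff]
    generalize (i : ℕ) = k at *
    generalize (j : ℕ) = l at *
    rcases lt_trichotomy k l with h | h | h
    · by_cases h' : l = k + 1
      · subst h'
        rw [if_pos (by omega), if_neg (by omega), if_neg (by omega), if_pos (by omega), ← hal]
        ring
      · rw [if_neg (by omega), if_neg (by omega), if_neg (by omega), if_neg (by omega)]
        ring
    · subst h; rfl
    · by_cases h' : k = l + 1
      · subst h'
        rw [if_neg (by omega), if_pos (by omega), if_pos (by omega), if_neg (by omega), ← hal]
        ring
      · rw [if_neg (by omega), if_neg (by omega), if_neg (by omega), if_neg (by omega)]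
        ring
  have hTx : T.mulVec x = x := by
    funext i
    have : ∀ j, T i j * x j = T j i * x i := by
      intro j
      rw [hx, hx, mul_div_assoc, mul_div_assoc, ← mul_assoc, hdb, mul_assoc]
    simp only [Matrix.mulVec, dotProduct, this]
    rw [← Finset.sum_mul, hc, one_mul]
  have hTnx : ∀ n, (T ^ n).mulVec x = x := by
    intro n
    induction n with
    | zero => simp
    | succ n ih => rw [pow_succ, ← Matrix.mulVec_mulVec, hTx, ih]
  have hx1 : ∑ m, x m = 1 := by
    simp only [hx, mul_div_assoc]
    rw [← Finset.sum_mul, Fin.sum_univ_eq_sum_range (fun m => a ^ m), ← mul_div_assoc,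
      geom_sum_mul, div_self haN]
  have hrow : ∀ n : ℕ, ∀ j : Fin (M + 2),
      lam ^ n ≤ (T ^ n) (⟨(j : ℕ) - n, by omega⟩ : Fin (M + 2)) j := by
    intro n
    induction n with
    | zero => intro j; simp
    | succ n ih =>
      intro j
      rw [pow_succ', pow_succ', Matrix.mul_apply]
      refine le_trans ?_ (Finset.single_le_sum
        (fun k _ => mul_nonneg (h0 _ k) ((pow_stoch T h0 hc n).1 k j))
        (Finset.mem_univ (⟨(j : ℕ) - n, by omega⟩ : Fin (M + 2))))
      refine mul_le_mul ?_ (ih j) (by positivity) (h0 _ _)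
      rw [hT', if_pos (by simp only [Fin.ext_iff]; omega)]
      split_ifs <;> linarith
  have hd : ∀ j, lam ^ (M + 2) ≤ (T ^ (M + 2)) 0 j := by
    intro j
    have := hrow (M + 2) j
    have e : (⟨(j : ℕ) - (M + 2), by omega⟩ : Fin (M + 2)) = 0 := by
      simp only [Fin.ext_iff, Fin.val_zero]; omega
    rwa [e] at this
  have key := l1_tendsto T 0 (lam ^ (M + 2)) (by positivity) (M + 2) h0 hc hd (p - x)
    (by simp [hp1, hx1])
  rw [tendsto_pi_nhds]
  intro i
  rw [tendsto_iff_norm_sub_tendsto_zero]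
  refine squeeze_zero (fun n => norm_nonneg _) (fun n => ?_) key
  have : (T ^ n).mulVec p i - x i = (T ^ n).mulVec (p - x) i := by
    rw [Matrix.mulVec_sub, hTnx]; rfl
  rw [this, Real.norm_eq_abs]
  exact Finset.single_le_sum (f := fun i => |(T ^ n).mulVec (p - x) i|)
    (fun k _ => abs_nonneg _) (Finset.mem_univ i)
end
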